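/- Let k be an algebraically closed field of characteristic 0, Γ an abelian group, and V a finite-dimensional Yetter–Drinfeld module over kΓ with a basis x_1,…,x_m of homogeneous elements, deg x_i = h_i ∈ Γ. Suppose there are two indices, say 1 and 2, and scalars q_12, q_21, q_22 ∈ k^× with h_1·x_1 = x_1, h_1·x_2 = q_12·x_2, h_2·x_1 = q_21·x_1, h_2·x_2 = q_22·x_2, and q_12·q_21 ≠ 1. Then GKdim B(V) = ∞. -/

import Mathlib

open scoped ENNReal

/-- The Gelfand–Kirillov dimension of a `k`-algebra `A`. -/
noncomputable def GKdim (k A : Type*) [Field k] [Ring A] [Algebra k A] : ℝ≥0∞ :=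
  ⨆ (V : Submodule k A) (_ : FiniteDimensional k V),
    Filter.limsup
      (fun n : ℕ =>
        ENNReal.ofReal
          (Real.log ((Module.finrank k (↥(∑ j ∈ Finset.range (n + 1), V ^ j)) : ℕ) : ℝ) /
            Real.log (n : ℝ)))
      Filter.atTop

/-- The degree-`n` homogeneous component of the free algebra on `m` generators. -/
noncomputable def degComp (k : Type*) [Field k] (m n : ℕ) :
    Submodule k (FreeAlgebra k (Fin m)) :=
  (Submodule.span k (Set.range (FreeAlgebra.ι k : Fin m → FreeAlgebra k (Fin m)))) ^ n

/-- Generating set of the defining ideal of the Nichols algebra. -/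
def nicholsSet {k : Type*} [Field k] {m : ℕ}
    (D : Fin m → (FreeAlgebra k (Fin m) →ₗ[k] FreeAlgebra k (Fin m))) :
    Set (FreeAlgebra k (Fin m)) :=
  {x | ∃ n : ℕ, 2 ≤ n ∧ x ∈ degComp k m n ∧
    ∀ l : List (Fin m), l.length = n → l.foldr (fun i y => D i y) x = 0}

/-- Relation presenting the Nichols algebra as a `RingQuot`. -/
def nicholsRel {k : Type*} [Field k] {m : ℕ}
    (D : Fin m → (FreeAlgebra k (Fin m) →ₗ[k] FreeAlgebra k (Fin m)))
    (a b : FreeAlgebra k (Fin m)) : Prop :=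
  a ∈ nicholsSet D ∧ b = 0

section NicholsLayers

variable {k : Type*} [Field k] {m : ℕ}

/-- The elements of the free algebra on which every composition of at most `n` of the
operators `D i` has vanishing constant term. -/
noncomputable def nicholsLayer (D : Fin m → (FreeAlgebra k (Fin m) →ₗ[k] FreeAlgebra k (Fin m))) :
    ℕ → Submodule k (FreeAlgebra k (Fin m))
  | 0 => LinearMap.ker (FreeAlgebra.algebraMapInv (R := k) (X := Fin m)).toLinearMap
  | n + 1 => LinearMap.ker (FreeAlgebra.algebraMapInv (R := k) (X := Fin m)).toLinearMap ⊓
      ⨅ i, (nicholsLayer D n).comap (D i)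

variable {D : Fin m → (FreeAlgebra k (Fin m) →ₗ[k] FreeAlgebra k (Fin m))}

theorem mem_nicholsLayer_zero {x : FreeAlgebra k (Fin m)} :
    x ∈ nicholsLayer D 0 ↔ FreeAlgebra.algebraMapInv x = 0 := by
  simp [nicholsLayer]

theorem mem_nicholsLayer_succ {n : ℕ} {x : FreeAlgebra k (Fin m)} :
    x ∈ nicholsLayer D (n + 1) ↔
      FreeAlgebra.algebraMapInv x = 0 ∧ ∀ i, D i x ∈ nicholsLayer D n := by
  simp [nicholsLayer]

theorem algebraMapInv_eq_zero_of_mem_nicholsLayer {n : ℕ} {x : FreeAlgebra k (Fin m)}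
    (hx : x ∈ nicholsLayer D n) : FreeAlgebra.algebraMapInv x = 0 := by
  cases n with
  | zero => exact mem_nicholsLayer_zero.1 hx
  | succ n => exact (mem_nicholsLayer_succ.1 hx).1

theorem nicholsLayer_succ_le (n : ℕ) : nicholsLayer D (n + 1) ≤ nicholsLayer D n := by
  induction n with
  | zero => exact fun x hx => mem_nicholsLayer_zero.2 (mem_nicholsLayer_succ.1 hx).1
  | succ n ih =>
    intro x hx
    obtain ⟨h0, h⟩ := mem_nicholsLayer_succ.1 hx
    exact mem_nicholsLayer_succ.2 ⟨h0, fun i => ih (h i)⟩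

theorem algebraMapInv_eq_zero_of_mem_degComp_succ {n : ℕ} {x : FreeAlgebra k (Fin m)}
    (hx : x ∈ degComp k m (n + 1)) : FreeAlgebra.algebraMapInv x = 0 := by
  rw [degComp, pow_succ] at hx
  induction hx using Submodule.mul_induction_on' with
  | mem_mul_mem u _ v hv =>
    have : FreeAlgebra.algebraMapInv v = 0 := by
      induction hv using Submodule.span_induction with
      | mem x h =>
        obtain ⟨j, rfl⟩ := h
        simp [FreeAlgebra.algebraMapInv]
      | zero => simp
      | add x y _ _ hx hy => simp [hx, hy]
      | smul a x _ hx => simp [hx]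
    simp [this]
  | add x _ y _ hx hy => simp [hx, hy]

end NicholsLayers

section SkewDerivations

variable {k : Type*} [Field k] {Γ : Type*} {m : ℕ} {dg : Fin m → Γ}
  {act : Γ → (FreeAlgebra k (Fin m) →ₐ[k] FreeAlgebra k (Fin m))}
  {D : Fin m → (FreeAlgebra k (Fin m) →ₗ[k] FreeAlgebra k (Fin m))}

theorem act_mem_span_range_ι
    (hYD : ∀ (g : Γ) (j : Fin m), act g (FreeAlgebra.ι k j) ∈
      Submodule.span k {y | ∃ l : Fin m, dg l = dg j ∧ y = FreeAlgebra.ι k l})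
    (g : Γ) {x : FreeAlgebra k (Fin m)}
    (hx : x ∈ Submodule.span k (Set.range (FreeAlgebra.ι k : Fin m → FreeAlgebra k (Fin m)))) :
    act g x ∈ Submodule.span k (Set.range (FreeAlgebra.ι k : Fin m → FreeAlgebra k (Fin m))) := by
  induction hx using Submodule.span_induction with
  | mem x h =>
    obtain ⟨j, rfl⟩ := h
    refine Submodule.span_mono ?_ (hYD g j)
    rintro _ ⟨l, -, rfl⟩
    exact ⟨l, rfl⟩
  | zero => simp
  | add x y _ _ hx hy => rw [map_add]; exact add_mem hx hy
  | smul a x _ hx => rw [map_smul]; exact Submodule.smul_mem _ _ hx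

theorem skewDerivation_algebraMap
    (hD1 : ∀ i, D i (1 : FreeAlgebra k (Fin m)) = 0) (i : Fin m) (r : k) :
    D i (algebraMap k _ r) = 0 := by
  rw [Algebra.algebraMap_eq_smul_one, map_smul, hD1, smul_zero]

theorem skewDerivation_mem_one_of_mem_span
    (hDx : ∀ i j, D i (FreeAlgebra.ι k j) = if i = j then 1 else 0)
    (i : Fin m) {x : FreeAlgebra k (Fin m)}
    (hx : x ∈ Submodule.span k (Set.range (FreeAlgebra.ι k : Fin m → FreeAlgebra k (Fin m)))) :
    D i x ∈ (1 : Submodule k (FreeAlgebra k (Fin m))) := by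
  induction hx using Submodule.span_induction with
  | mem x h =>
    obtain ⟨j, rfl⟩ := h
    rw [hDx]
    split_ifs
    · exact Submodule.one_le.1 le_rfl
    · exact zero_mem _
  | zero => simp
  | add x y _ _ hx hy => rw [map_add]; exact add_mem hx hy
  | smul a x _ hx => rw [map_smul]; exact Submodule.smul_mem _ _ hx

theorem skewDerivation_mem_degComp
    (hYD : ∀ (g : Γ) (j : Fin m), act g (FreeAlgebra.ι k j) ∈
      Submodule.span k {y | ∃ l : Fin m, dg l = dg j ∧ y = FreeAlgebra.ι k l})
    (hDx : ∀ i j, D i (FreeAlgebra.ι k j) = if i = j then 1 else 0)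
    (hDmul : ∀ i (u v : FreeAlgebra k (Fin m)),
      D i (u * v) = D i u * act (dg i) v + u * D i v)
    (i : Fin m) {n : ℕ} {x : FreeAlgebra k (Fin m)} (hx : x ∈ degComp k m (n + 1)) :
    D i x ∈ degComp k m n := by
  induction n generalizing x with
  | zero =>
    rw [degComp, zero_add, pow_one] at hx
    rw [degComp, pow_zero]
    exact skewDerivation_mem_one_of_mem_span hDx i hx
  | succ n ih =>
    rw [degComp, pow_succ] at hx
    induction hx using Submodule.mul_induction_on' with
    | mem_mul_mem u hu v hv =>
      rw [hDmul]
      refine add_mem ?_ ?_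
      · rw [degComp, pow_succ]
        exact Submodule.mul_mem_mul (ih hu) (act_mem_span_range_ι hYD _ hv)
      · have := Submodule.mul_mem_mul hu (skewDerivation_mem_one_of_mem_span hDx i hv)
        rwa [mul_one] at this
    | add x _ y _ hx hy => rw [map_add]; exact add_mem hx hy

theorem skewDerivation_act [CommGroup Γ]
    (hactmul : ∀ (g h : Γ) (x), act (g * h) x = act g (act h x))
    (hYD : ∀ (g : Γ) (j : Fin m), act g (FreeAlgebra.ι k j) ∈
      Submodule.span k {y | ∃ l : Fin m, dg l = dg j ∧ y = FreeAlgebra.ι k l})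
    (hD1 : ∀ i, D i (1 : FreeAlgebra k (Fin m)) = 0)
    (hDx : ∀ i j, D i (FreeAlgebra.ι k j) = if i = j then 1 else 0)
    (hDmul : ∀ i (u v : FreeAlgebra k (Fin m)),
      D i (u * v) = D i u * act (dg i) v + u * D i v)
    (g : Γ) (i : Fin m) :
    ∃ a : Fin m → k, ∀ x, D i (act g x) = ∑ j, a j • act g (D j x) := by
  have key : ∀ j, ∃ a : k, D i (act g (FreeAlgebra.ι k j)) = algebraMap k _ a ∧
      (a ≠ 0 → dg i = dg j) := by
    intro j
    have h := hYD g j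
    generalize act g (FreeAlgebra.ι k j) = y at h
    induction h using Submodule.span_induction with
    | mem x h =>
      obtain ⟨l, hl, rfl⟩ := h
      refine ⟨if i = l then 1 else 0, ?_, ?_⟩
      · rw [hDx]; split_ifs <;> simp
      · split_ifs with h
        · subst h; exact fun _ => hl
        · simp
    | zero => exact ⟨0, by simp, by simp⟩
    | add x y _ _ hx hy =>
      obtain ⟨a, ha, ha'⟩ := hx
      obtain ⟨b, hb, hb'⟩ := hy
      refine ⟨a + b, by simp [ha, hb], fun h => ?_⟩
      by_cases h0 : a = 0
      · exact hb' (by simpa [h0] using h)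
      · exact ha' h0
    | smul r x _ hx =>
      obtain ⟨a, ha, ha'⟩ := hx
      refine ⟨r * a, by rw [map_smul, ha, map_mul, Algebra.smul_def], fun h => ?_⟩
      exact ha' (right_ne_zero_of_mul h)
  choose a ha ha' using key
  refine ⟨a, fun x => ?_⟩
  induction x using FreeAlgebra.induction with
  | grade0 r => simp [skewDerivation_algebraMap hD1]
  | grade1 j =>
    rw [ha, Finset.sum_eq_single j]
    · simp [hDx, Algebra.algebraMap_eq_smul_one]
    · intro l _ hl
      simp [hDx, hl]
    · simp
  | mul u v hu hv =>
    rw [map_mul, hDmul, hu, hv, Finset.sum_mul, Finset.mul_sum, ← Finset.sum_add_distrib]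
    refine Finset.sum_congr rfl fun j _ => ?_
    by_cases h0 : a j = 0
    · simp [h0]
    · rw [hDmul, map_add, map_mul, map_mul, smul_add, ← hactmul, ha' j h0, mul_comm (dg j),
        hactmul, smul_mul_assoc, mul_smul_comm]
  | add u v hu hv => simp only [map_add, hu, hv, smul_add, Finset.sum_add_distrib]

theorem algebraMapInv_act
    (hYD : ∀ (g : Γ) (j : Fin m), act g (FreeAlgebra.ι k j) ∈
      Submodule.span k {y | ∃ l : Fin m, dg l = dg j ∧ y = FreeAlgebra.ι k l})
    (g : Γ) (x : FreeAlgebra k (Fin m)) :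
    FreeAlgebra.algebraMapInv (act g x) = FreeAlgebra.algebraMapInv x := by
  induction x using FreeAlgebra.induction with
  | grade0 r => simp
  | grade1 j =>
    rw [algebraMapInv_eq_zero_of_mem_degComp_succ (n := 0),
      algebraMapInv_eq_zero_of_mem_degComp_succ (n := 0)]
    · rw [degComp, zero_add, pow_one]
      exact Submodule.subset_span ⟨j, rfl⟩
    · rw [degComp, zero_add, pow_one]
      exact act_mem_span_range_ι hYD g (Submodule.subset_span ⟨j, rfl⟩)
  | mul u v hu hv => simp [hu, hv]
  | add u v hu hv => simp [hu, hv]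

theorem act_mem_nicholsLayer [CommGroup Γ]
    (hactmul : ∀ (g h : Γ) (x), act (g * h) x = act g (act h x))
    (hYD : ∀ (g : Γ) (j : Fin m), act g (FreeAlgebra.ι k j) ∈
      Submodule.span k {y | ∃ l : Fin m, dg l = dg j ∧ y = FreeAlgebra.ι k l})
    (hD1 : ∀ i, D i (1 : FreeAlgebra k (Fin m)) = 0)
    (hDx : ∀ i j, D i (FreeAlgebra.ι k j) = if i = j then 1 else 0)
    (hDmul : ∀ i (u v : FreeAlgebra k (Fin m)),
      D i (u * v) = D i u * act (dg i) v + u * D i v)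
    (g : Γ) {n : ℕ} {x : FreeAlgebra k (Fin m)} (hx : x ∈ nicholsLayer D n) :
    act g x ∈ nicholsLayer D n := by
  induction n generalizing x with
  | zero =>
    rw [mem_nicholsLayer_zero] at hx ⊢
    rw [algebraMapInv_act hYD, hx]
  | succ n ih =>
    rw [mem_nicholsLayer_succ] at hx ⊢
    refine ⟨by rw [algebraMapInv_act hYD, hx.1], fun i => ?_⟩
    obtain ⟨a, ha⟩ := skewDerivation_act hactmul hYD hD1 hDx hDmul g i
    rw [ha]
    exact sum_mem fun j _ => Submodule.smul_mem _ _ (ih (hx.2 j))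

theorem mul_mem_nicholsLayer_right
    (hDmul : ∀ i (u v : FreeAlgebra k (Fin m)),
      D i (u * v) = D i u * act (dg i) v + u * D i v)
    {n : ℕ} {u : FreeAlgebra k (Fin m)} (v : FreeAlgebra k (Fin m)) (hu : u ∈ nicholsLayer D n) :
    u * v ∈ nicholsLayer D n := by
  induction n generalizing u v with
  | zero =>
    rw [mem_nicholsLayer_zero] at hu ⊢
    rw [map_mul, hu, zero_mul]
  | succ n ih =>
    have hu' := nicholsLayer_succ_le n hu
    rw [mem_nicholsLayer_succ] at hu ⊢
    refine ⟨by rw [map_mul, hu.1, zero_mul], fun i => ?_⟩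
    rw [hDmul]
    exact add_mem (ih _ (hu.2 i)) (ih _ hu')

theorem mul_mem_nicholsLayer_left [CommGroup Γ]
    (hactmul : ∀ (g h : Γ) (x), act (g * h) x = act g (act h x))
    (hYD : ∀ (g : Γ) (j : Fin m), act g (FreeAlgebra.ι k j) ∈
      Submodule.span k {y | ∃ l : Fin m, dg l = dg j ∧ y = FreeAlgebra.ι k l})
    (hD1 : ∀ i, D i (1 : FreeAlgebra k (Fin m)) = 0)
    (hDx : ∀ i j, D i (FreeAlgebra.ι k j) = if i = j then 1 else 0)
    (hDmul : ∀ i (u v : FreeAlgebra k (Fin m)),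
      D i (u * v) = D i u * act (dg i) v + u * D i v)
    {n : ℕ} (u : FreeAlgebra k (Fin m)) {v : FreeAlgebra k (Fin m)} (hv : v ∈ nicholsLayer D n) :
    u * v ∈ nicholsLayer D n := by
  induction n generalizing u v with
  | zero =>
    rw [mem_nicholsLayer_zero] at hv ⊢
    rw [map_mul, hv, mul_zero]
  | succ n ih =>
    have hv' := act_mem_nicholsLayer hactmul hYD hD1 hDx hDmul
    have hv'' := nicholsLayer_succ_le n hv
    rw [mem_nicholsLayer_succ] at hv ⊢
    refine ⟨by rw [map_mul, hv.1, mul_zero], fun i => ?_⟩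
    rw [hDmul]
    exact add_mem (ih _ (hv' _ hv'')) (ih _ (hv.2 i))

theorem mem_nicholsLayer_of_forall_foldr_eq_zero
    (hYD : ∀ (g : Γ) (j : Fin m), act g (FreeAlgebra.ι k j) ∈
      Submodule.span k {y | ∃ l : Fin m, dg l = dg j ∧ y = FreeAlgebra.ι k l})
    (hDx : ∀ i j, D i (FreeAlgebra.ι k j) = if i = j then 1 else 0)
    (hDmul : ∀ i (u v : FreeAlgebra k (Fin m)),
      D i (u * v) = D i u * act (dg i) v + u * D i v)
    (r : ℕ) {n : ℕ} {x : FreeAlgebra k (Fin m)} (hx : x ∈ degComp k m n)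
    (h : ∀ l : List (Fin m), l.length = n → l.foldr (fun i y => D i y) x = 0) :
    x ∈ nicholsLayer D r := by
  induction r generalizing n x with
  | zero =>
    cases n with
    | zero => rw [show x = 0 from h [] rfl]; exact zero_mem _
    | succ n => exact mem_nicholsLayer_zero.2 (algebraMapInv_eq_zero_of_mem_degComp_succ hx)
  | succ r ih =>
    cases n with
    | zero => rw [show x = 0 from h [] rfl]; exact zero_mem _
    | succ n =>
      refine mem_nicholsLayer_succ.2 ⟨algebraMapInv_eq_zero_of_mem_degComp_succ hx, fun i => ?_⟩
      refine ih (skewDerivation_mem_degComp hYD hDx hDmul i hx) fun l hl => ?_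
      have := h (l ++ [i]) (by simp [hl])
      simpa using this

theorem mem_nicholsLayer_of_mkAlgHom_eq_zero [CommGroup Γ]
    (hactmul : ∀ (g h : Γ) (x), act (g * h) x = act g (act h x))
    (hYD : ∀ (g : Γ) (j : Fin m), act g (FreeAlgebra.ι k j) ∈
      Submodule.span k {y | ∃ l : Fin m, dg l = dg j ∧ y = FreeAlgebra.ι k l})
    (hD1 : ∀ i, D i (1 : FreeAlgebra k (Fin m)) = 0)
    (hDx : ∀ i j, D i (FreeAlgebra.ι k j) = if i = j then 1 else 0)
    (hDmul : ∀ i (u v : FreeAlgebra k (Fin m)),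
      D i (u * v) = D i u * act (dg i) v + u * D i v)
    {x : FreeAlgebra k (Fin m)} (hx : RingQuot.mkAlgHom k (nicholsRel D) x = 0) (r : ℕ) :
    x ∈ nicholsLayer D r := by
  let J : TwoSidedIdeal (FreeAlgebra k (Fin m)) :=
    TwoSidedIdeal.mk' (⨅ r, nicholsLayer D r : Submodule k (FreeAlgebra k (Fin m)))
      (zero_mem _) (fun hx hy => add_mem hx hy) (fun hx => neg_mem hx)
      (fun {u v} hv => by
        simp only [SetLike.mem_coe, Submodule.mem_iInf] at hv ⊢
        exact fun r => mul_mem_nicholsLayer_left hactmul hYD hD1 hDx hDmul u (hv r))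
      (fun {u v} hu => by
        simp only [SetLike.mem_coe, Submodule.mem_iInf] at hu ⊢
        exact fun r => mul_mem_nicholsLayer_right hDmul v (hu r))
  have hJ : ∀ y, y ∈ J ↔ ∀ r, y ∈ nicholsLayer D r := fun y => by
    rw [TwoSidedIdeal.mem_mk']
    simp only [SetLike.mem_coe, Submodule.mem_iInf]
  have hrel : ∀ ⦃a b⦄, nicholsRel D a b → J.ringCon.mk' a = J.ringCon.mk' b := by
    rintro a b ⟨⟨n, -, ha, hl⟩, rfl⟩
    have : a ∈ J := (hJ a).2 fun r =>
      mem_nicholsLayer_of_forall_foldr_eq_zero hYD hDx hDmul r ha hl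
    exact (RingCon.eq _).2 ((TwoSidedIdeal.mem_iff J a).1 this)
  have h1 : RingQuot.lift ⟨J.ringCon.mk', hrel⟩ (RingQuot.mkRingHom (nicholsRel D) x) = 0 := by
    have hx' : RingQuot.mkRingHom (nicholsRel D) x = 0 := by
      rw [← RingQuot.mkAlgHom_coe k]
      exact hx
    rw [hx', map_zero]
  rw [RingQuot.lift_mkRingHom_apply] at h1
  exact (hJ x).1 ((TwoSidedIdeal.mem_iff J x).2 ((RingCon.eq _).1 h1)) r

end SkewDerivations

section IteratedBrackets

variable {k : Type*} [Field k] {m : ℕ}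

/-- The iterated braided bracket `(ad x_i)^n x_j` for the braiding scalar `q`. -/
noncomputable def iteratedBracket (q : k) (i j : Fin m) : ℕ → FreeAlgebra k (Fin m)
  | 0 => FreeAlgebra.ι k j
  | n + 1 => FreeAlgebra.ι k i * iteratedBracket q i j n -
      q • (iteratedBracket q i j n * FreeAlgebra.ι k i)

theorem map_iteratedBracket {f : FreeAlgebra k (Fin m) →ₐ[k] FreeAlgebra k (Fin m)} {i j : Fin m}
    {a b : k} (q : k) (hi : f (FreeAlgebra.ι k i) = a • FreeAlgebra.ι k i)
    (hj : f (FreeAlgebra.ι k j) = b • FreeAlgebra.ι k j) (n : ℕ) :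
    f (iteratedBracket q i j n) = (a ^ n * b) • iteratedBracket q i j n := by
  induction n with
  | zero => simp [iteratedBracket, hj]
  | succ n ih =>
    simp only [iteratedBracket, map_sub, map_mul, map_smul, hi, ih, smul_mul_assoc,
      mul_smul_comm, smul_sub, smul_smul]
    congr 2 <;> ring

theorem iteratedBracket_mem_pow {A : Type*} [Ring A] [Algebra k A]
    (π : FreeAlgebra k (Fin m) →ₐ[k] A) {V : Submodule k A} {i j : Fin m} (q : k)
    (hi : π (FreeAlgebra.ι k i) ∈ V) (hj : π (FreeAlgebra.ι k j) ∈ V) (n : ℕ) :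
    π (iteratedBracket q i j n) ∈ V ^ (n + 1) := by
  induction n with
  | zero => simpa [iteratedBracket] using hj
  | succ n ih =>
    rw [iteratedBracket, map_sub, map_smul, map_mul, map_mul]
    refine sub_mem ?_ (Submodule.smul_mem _ _ ?_)
    · rw [pow_succ']; exact Submodule.mul_mem_mul hi ih
    · rw [pow_succ]; exact Submodule.mul_mem_mul ih hi

variable {Γ : Type*} {dg : Fin m → Γ}
  {act : Γ → (FreeAlgebra k (Fin m) →ₐ[k] FreeAlgebra k (Fin m))}
  {D : Fin m → (FreeAlgebra k (Fin m) →ₗ[k] FreeAlgebra k (Fin m))}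
  {i j : Fin m} {q q' q'' : k}

theorem skewDerivation_iteratedBracket_eq_zero
    (hDx : ∀ i j, D i (FreeAlgebra.ι k j) = if i = j then 1 else 0)
    (hDmul : ∀ i (u v : FreeAlgebra k (Fin m)),
      D i (u * v) = D i u * act (dg i) v + u * D i v)
    (hne : i ≠ j) (hii : act (dg i) (FreeAlgebra.ι k i) = FreeAlgebra.ι k i)
    (hij : act (dg i) (FreeAlgebra.ι k j) = q • FreeAlgebra.ι k j) (n : ℕ) :
    D i (iteratedBracket q i j n) = 0 := by
  induction n with
  | zero => simp [iteratedBracket, hDx, hne]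
  | succ n ih =>
    have hz := map_iteratedBracket q (hii.trans (one_smul k _).symm) hij n
    simp [iteratedBracket, hDmul, ih, hDx, hz]

theorem skewDerivation_iteratedBracket
    (hDx : ∀ i j, D i (FreeAlgebra.ι k j) = if i = j then 1 else 0)
    (hDmul : ∀ i (u v : FreeAlgebra k (Fin m)),
      D i (u * v) = D i u * act (dg i) v + u * D i v)
    (hne : i ≠ j) (hji : act (dg j) (FreeAlgebra.ι k i) = q' • FreeAlgebra.ι k i) (n : ℕ) :
    D j (iteratedBracket q i j n) = (1 - q * q') ^ n • FreeAlgebra.ι k i ^ n := by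
  induction n with
  | zero => simp [iteratedBracket, hDx]
  | succ n ih =>
    simp only [iteratedBracket, map_sub, hDmul, hDx, hne.symm, if_false, zero_mul, zero_add,
      map_smul, ih, hji, mul_zero, add_zero, mul_smul_comm, smul_mul_assoc, ← pow_succ,
      ← pow_succ', smul_smul, ← sub_smul]
    congr 1
    ring

theorem skewDerivation_pow_mul_left
    (hDmul : ∀ i (u v : FreeAlgebra k (Fin m)),
      D i (u * v) = D i u * act (dg i) v + u * D i v)
    {w : FreeAlgebra k (Fin m)} (hw : D i w = 0) (y : FreeAlgebra k (Fin m)) (n : ℕ) :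
    (D i ^ n) (w * y) = w * (D i ^ n) y := by
  induction n with
  | zero => simp
  | succ n ih => rw [pow_succ', Module.End.mul_apply, ih, hDmul, hw, zero_mul, zero_add,
      Module.End.mul_apply]

theorem skewDerivation_pow_mul_right
    (hDmul : ∀ i (u v : FreeAlgebra k (Fin m)),
      D i (u * v) = D i u * act (dg i) v + u * D i v)
    {w : FreeAlgebra k (Fin m)} (hw : D i w = 0) (hw' : act (dg i) w = q • w)
    (y : FreeAlgebra k (Fin m)) (n : ℕ) :
    (D i ^ n) (y * w) = q ^ n • ((D i ^ n) y * w) := by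
  induction n with
  | zero => simp
  | succ n ih =>
    rw [pow_succ', Module.End.mul_apply, ih, map_smul, hDmul, hw, hw', mul_zero, add_zero,
      mul_smul_comm, smul_smul, ← pow_succ, Module.End.mul_apply]

theorem skewDerivation_ι_pow
    (hDx : ∀ i j, D i (FreeAlgebra.ι k j) = if i = j then 1 else 0)
    (hDmul : ∀ i (u v : FreeAlgebra k (Fin m)),
      D i (u * v) = D i u * act (dg i) v + u * D i v)
    (hii : act (dg i) (FreeAlgebra.ι k i) = FreeAlgebra.ι k i) (n : ℕ) :
    D i (FreeAlgebra.ι k i ^ (n + 1)) = ((n + 1 : ℕ) : k) • FreeAlgebra.ι k i ^ n := by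
  induction n with
  | zero => simp [hDx]
  | succ n ih =>
    rw [pow_succ, hDmul, ih, hii, hDx, if_pos rfl, mul_one, smul_mul_assoc, ← pow_succ]
    push_cast
    simp only [add_smul, one_smul]

theorem skewDerivation_pow_ι_pow
    (hDx : ∀ i j, D i (FreeAlgebra.ι k j) = if i = j then 1 else 0)
    (hDmul : ∀ i (u v : FreeAlgebra k (Fin m)),
      D i (u * v) = D i u * act (dg i) v + u * D i v)
    (hii : act (dg i) (FreeAlgebra.ι k i) = FreeAlgebra.ι k i) (n : ℕ) :
    (D i ^ n) (FreeAlgebra.ι k i ^ n) = (n.factorial : k) • 1 := by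
  induction n with
  | zero => simp
  | succ n ih =>
    rw [pow_succ, Module.End.mul_apply, skewDerivation_ι_pow hDx hDmul hii, map_smul, ih,
      smul_smul, Nat.factorial_succ, Nat.cast_mul]

theorem skewDerivation_pow_ι_pow_of_lt
    (hD1 : ∀ i, D i (1 : FreeAlgebra k (Fin m)) = 0)
    (hDx : ∀ i j, D i (FreeAlgebra.ι k j) = if i = j then 1 else 0)
    (hDmul : ∀ i (u v : FreeAlgebra k (Fin m)),
      D i (u * v) = D i u * act (dg i) v + u * D i v)
    (hii : act (dg i) (FreeAlgebra.ι k i) = FreeAlgebra.ι k i) {n r : ℕ} (h : n < r) :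
    (D i ^ r) (FreeAlgebra.ι k i ^ n) = 0 := by
  obtain ⟨s, rfl⟩ := Nat.exists_eq_add_of_lt h
  rw [show n + s + 1 = s + 1 + n by ring, pow_add, Module.End.mul_apply,
    skewDerivation_pow_ι_pow hDx hDmul hii, map_smul, pow_succ, Module.End.mul_apply, hD1,
    map_zero, smul_zero]

/-- The operator `∂_i ^ r ∘ ∂_j` on a product `w * (ad x_i)^n x_j`, where `w` is killed by it
and by `∂_i`. -/
theorem skewDerivation_pow_mul_iteratedBracket
    (hDx : ∀ i j, D i (FreeAlgebra.ι k j) = if i = j then 1 else 0)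
    (hDmul : ∀ i (u v : FreeAlgebra k (Fin m)),
      D i (u * v) = D i u * act (dg i) v + u * D i v)
    (hne : i ≠ j) (hii : act (dg i) (FreeAlgebra.ι k i) = FreeAlgebra.ι k i)
    (hij : act (dg i) (FreeAlgebra.ι k j) = q • FreeAlgebra.ι k j)
    (hji : act (dg j) (FreeAlgebra.ι k i) = q' • FreeAlgebra.ι k i)
    (hjj : act (dg j) (FreeAlgebra.ι k j) = q'' • FreeAlgebra.ι k j)
    {w : FreeAlgebra k (Fin m)} {r : ℕ} (hw : D i w = 0) (hwr : (D i ^ r) (D j w) = 0) (n : ℕ) :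
    (D i ^ r) (D j (w * iteratedBracket q i j n)) =
      (1 - q * q') ^ n • (w * (D i ^ r) (FreeAlgebra.ι k i ^ n)) := by
  have hz := map_iteratedBracket q (hii.trans (one_smul k _).symm) hij n
  rw [one_pow, one_mul] at hz
  rw [hDmul, map_iteratedBracket q hji hjj, skewDerivation_iteratedBracket hDx hDmul hne hji,
    map_add, mul_smul_comm, map_smul, mul_smul_comm, map_smul,
    skewDerivation_pow_mul_right hDmul
      (skewDerivation_iteratedBracket_eq_zero hDx hDmul hne hii hij n) hz,
    hwr, zero_mul, smul_zero, smul_zero, zero_add, skewDerivation_pow_mul_left hDmul hw]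

/-- The ordered products of distinct iterated brackets of index less than `N` form `2 ^ N`
elements of degree at most `N ^ 2`, linearly independent modulo the joint kernel of all
iterated skew derivations followed by the counit. -/
theorem exists_independent_products [CharZero k]
    (hD1 : ∀ i, D i (1 : FreeAlgebra k (Fin m)) = 0)
    (hDx : ∀ i j, D i (FreeAlgebra.ι k j) = if i = j then 1 else 0)
    (hDmul : ∀ i (u v : FreeAlgebra k (Fin m)),
      D i (u * v) = D i u * act (dg i) v + u * D i v)
    (hne : i ≠ j) (hii : act (dg i) (FreeAlgebra.ι k i) = FreeAlgebra.ι k i)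
    (hij : act (dg i) (FreeAlgebra.ι k j) = q • FreeAlgebra.ι k j)
    (hji : act (dg j) (FreeAlgebra.ι k i) = q' • FreeAlgebra.ι k i)
    (hjj : act (dg j) (FreeAlgebra.ι k j) = q'' • FreeAlgebra.ι k j)
    (hq : q * q' ≠ 1) {A : Type*} [Ring A] [Algebra k A]
    (π : FreeAlgebra k (Fin m) →ₐ[k] A) {V : Submodule k A} (h1 : 1 ≤ V)
    (hi : π (FreeAlgebra.ι k i) ∈ V) (hj : π (FreeAlgebra.ι k j) ∈ V) (N : ℕ) :
    ∃ (ι : Type) (_ : Fintype ι) (v : ι → FreeAlgebra k (Fin m)),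
      Fintype.card ι = 2 ^ N ∧ (∀ s, π (v s) ∈ V ^ (N ^ 2)) ∧
      (∀ s, D i (v s) = 0) ∧ (∀ s r, N ≤ r → (D i ^ r) (D j (v s)) = 0) ∧
      ∀ g : ι → k, (∀ r, ∑ s, g s • v s ∈ nicholsLayer D r) → ∀ s, g s = 0 := by
  induction N with
  | zero =>
    refine ⟨Unit, inferInstance, fun _ => 1, rfl, fun _ => ?_, fun _ => hD1 i,
      fun _ r _ => by rw [hD1, map_zero], fun g hg s => ?_⟩
    · simpa using Submodule.one_le.1 (le_refl (1 : Submodule k A))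
    · simpa [mem_nicholsLayer_zero] using hg 0
  | succ N ih =>
    obtain ⟨ι, _, v, hcard, hV, hDi, hE, hind⟩ := ih
    have hEz := fun s r (hr : N ≤ r) => skewDerivation_pow_mul_iteratedBracket hDx hDmul hne hii
      hij hji hjj (hDi s) (hE s r hr) N
    refine ⟨ι ⊕ ι, inferInstance, Sum.elim v fun s => v s * iteratedBracket q i j N,
      by rw [Fintype.card_sum, hcard]; ring, ?_, ?_, ?_, ?_⟩
    · rintro (s | s)
      · exact pow_le_pow_right₀ h1 (Nat.pow_le_pow_left N.le_succ 2) (hV s)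
      · have h := Submodule.mul_mem_mul (hV s) (iteratedBracket_mem_pow π q hi hj N)
        rw [← pow_add] at h
        rw [Sum.elim_inr, map_mul]
        exact pow_le_pow_right₀ h1 (by nlinarith) h
    · rintro (s | s)
      · exact hDi s
      · rw [Sum.elim_inr, hDmul, hDi,
          skewDerivation_iteratedBracket_eq_zero hDx hDmul hne hii hij, zero_mul, mul_zero,
          add_zero]
    · rintro (s | s) r hr
      · exact hE s r (by omega)
      · rw [Sum.elim_inr, hEz s r (by omega),
          skewDerivation_pow_ι_pow_of_lt hD1 hDx hDmul hii (by omega), mul_zero, smul_zero]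
    · intro g hg
      simp only [Fintype.sum_sum_type, Sum.elim_inl, Sum.elim_inr] at hg
      have hstable : ∀ (l : Fin m) (x : FreeAlgebra k (Fin m)),
          (∀ r, x ∈ nicholsLayer D r) → ∀ r, D l x ∈ nicholsLayer D r :=
        fun l x hx r => (mem_nicholsLayer_succ.1 (hx (r + 1))).2 l
      have hstable' : ∀ (n : ℕ) (x : FreeAlgebra k (Fin m)),
          (∀ r, x ∈ nicholsLayer D r) → ∀ r, (D i ^ n) x ∈ nicholsLayer D r := by
        intro n
        induction n with
        | zero => exact fun x hx => by simpa using hx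
        | succ n ihn =>
          intro x hx
          rw [pow_succ, Module.End.mul_apply]
          exact ihn _ (hstable i x hx)
      have hr : ∀ s, g (Sum.inr s) = 0 := by
        have h := hstable' N _ (hstable j _ hg)
        simp only [map_add, map_sum, map_smul, hE _ N le_rfl, hEz _ N le_rfl,
          skewDerivation_pow_ι_pow hDx hDmul hii, smul_zero, Finset.sum_const_zero, zero_add,
          mul_smul_comm, mul_one, smul_smul] at h
        intro s
        have hs := hind _ h s
        have hc : (1 - q * q') ^ N ≠ 0 := pow_ne_zero _ (sub_ne_zero.2 hq.symm)
        have hf : (N.factorial : k) ≠ 0 := Nat.cast_ne_zero.2 N.factorial_ne_zero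
        simpa [hc, hf] using hs
      rintro (s | s)
      · refine hind (fun s => g (Sum.inl s)) (fun r => ?_) s
        simpa [hr] using hg r
      · exact hr s

end IteratedBrackets

theorem GKdim_eq_top_of_two_pow_le {k A : Type*} [Field k] [Ring A] [Algebra k A]
    (V : Submodule k A) [FiniteDimensional k V]
    (h : ∀ N : ℕ, ∃ (ι : Type) (_ : Fintype ι) (v : ι → A),
      Fintype.card ι = 2 ^ N ∧ (∀ s, v s ∈ V ^ (N ^ 2)) ∧ LinearIndependent k v) :
    GKdim k A = ⊤ := by
  have hfin : ∀ n : ℕ, FiniteDimensional k ↥(∑ j ∈ Finset.range (n + 1), V ^ j) := fun n =>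
    Module.Finite.iff_fg.2 <| Finset.sum_induction _ Submodule.FG (fun _ _ => Submodule.FG.sup)
      Submodule.fg_bot fun j _ => (Module.Finite.iff_fg.1 ‹_›).pow j
  have hrank : ∀ n : ℕ,
      2 ^ n.sqrt ≤ Module.finrank k ↥(∑ j ∈ Finset.range (n + 1), V ^ j) := by
    intro n
    obtain ⟨ι, _, v, hcard, hV, hv⟩ := h n.sqrt
    have := hfin n
    have hmem : ∀ s, v s ∈ ∑ j ∈ Finset.range (n + 1), V ^ j := fun s =>
      Finset.single_le_sum (f := fun j => V ^ j) (fun _ _ => bot_le)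
        (Finset.mem_range.2 (Nat.lt_succ_of_le (Nat.sqrt_le' n))) (hV s)
    have hli : LinearIndependent k
        fun s => (⟨v s, hmem s⟩ : ↥(∑ j ∈ Finset.range (n + 1), V ^ j)) :=
      LinearIndependent.of_comp (Submodule.subtype _) hv
    rw [← hcard]
    exact hli.fintype_card_le_finrank
  have hlim : Filter.Tendsto (fun n : ℕ =>
      Real.log ((Module.finrank k (↥(∑ j ∈ Finset.range (n + 1), V ^ j)) : ℕ) : ℝ) /
        Real.log (n : ℝ)) Filter.atTop Filter.atTop := by
    refine Filter.tendsto_atTop.2 fun b => ?_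
    set c := max b 1
    have hc : 0 < c := lt_max_of_lt_right one_pos
    have h2 : 0 < Real.log 2 := Real.log_pos one_lt_two
    have hsqrt : Filter.Tendsto (fun n : ℕ => ((n.sqrt + 1 : ℕ) : ℝ)) Filter.atTop Filter.atTop :=
      tendsto_natCast_atTop_atTop.comp <| (Filter.tendsto_add_atTop_nat 1).comp <|
        Filter.tendsto_atTop_atTop.2 fun b => ⟨b ^ 2, fun n hn => Nat.le_sqrt'.2 hn⟩
    have hlog := hsqrt.eventually
      (Real.isLittleO_log_id_atTop.bound (c := Real.log 2 / (4 * c)) (by positivity))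
    filter_upwards [hlog, Filter.eventually_ge_atTop 2] with n hn hn2
    have hN : 1 ≤ n.sqrt := Nat.le_sqrt'.2 (by omega)
    have hNr : (1 : ℝ) ≤ (n.sqrt : ℝ) := by exact_mod_cast hN
    have hn0 : (0 : ℝ) < n := by positivity
    have hlogn : 0 < Real.log n := Real.log_pos (by exact_mod_cast hn2)
    have hle : Real.log n ≤ 2 * Real.log ((n.sqrt + 1 : ℕ) : ℝ) := by
      have : (n : ℝ) ≤ ((n.sqrt + 1 : ℕ) : ℝ) ^ 2 := by
        exact_mod_cast (Nat.lt_succ_sqrt' n).le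
      have := Real.log_le_log hn0 this
      rwa [Real.log_pow, Nat.cast_ofNat] at this
    have hup : Real.log ((n.sqrt + 1 : ℕ) : ℝ) ≤ Real.log 2 / (4 * c) * (n.sqrt + 1) := by
      have := (le_abs_self _).trans hn
      simpa [abs_of_nonneg (by positivity : (0 : ℝ) ≤ n.sqrt + 1)] using this
    have hlow : n.sqrt * Real.log 2 ≤
        Real.log ((Module.finrank k (↥(∑ j ∈ Finset.range (n + 1), V ^ j)) : ℕ) : ℝ) := by
      rw [← Real.log_pow]
      exact Real.log_le_log (by positivity) (by exact_mod_cast hrank n)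
    refine (le_max_left b 1).trans ?_
    rw [le_div_iff₀ hlogn]
    refine le_trans ?_ hlow
    calc c * Real.log n
        ≤ c * (2 * (Real.log 2 / (4 * c) * (n.sqrt + 1))) := by gcongr; linarith
      _ = (n.sqrt + 1) / 2 * Real.log 2 := by field_simp; ring
      _ ≤ n.sqrt * Real.log 2 := by gcongr; linarith
  refine top_unique ?_
  rw [← (ENNReal.tendsto_ofReal_atTop.comp hlim).limsup_eq]
  exact le_iSup₂_of_le V ‹_› le_rfl

/-- If a Yetter–Drinfeld module over `kΓ` (`Γ` abelian) with homogeneous basis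
`x_1,…,x_m` has two indices `i₁ ≠ i₂` with `h_{i₁}·x_{i₁} = x_{i₁}`, `h_{i₁}·x_{i₂} = q₁₂ x_{i₂}`,
`h_{i₂}·x_{i₁} = q₂₁ x_{i₁}`, `h_{i₂}·x_{i₂} = q₂₂ x_{i₂}` and `q₁₂q₂₁ ≠ 1`, then
`GKdim B(V) = ∞`. -/
theorem statement6 (k : Type*) [Field k] [IsAlgClosed k] [CharZero k]
    (Γ : Type*) [CommGroup Γ] (m : ℕ)
    (dg : Fin m → Γ)
    (act : Γ → (FreeAlgebra k (Fin m) →ₐ[k] FreeAlgebra k (Fin m)))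
    (hact1 : ∀ x, act 1 x = x)
    (hactmul : ∀ (g h : Γ) (x), act (g * h) x = act g (act h x))
    (hYD : ∀ (g : Γ) (j : Fin m), act g (FreeAlgebra.ι k j) ∈
      Submodule.span k {y | ∃ l : Fin m, dg l = dg j ∧ y = FreeAlgebra.ι k l})
    (D : Fin m → (FreeAlgebra k (Fin m) →ₗ[k] FreeAlgebra k (Fin m)))
    (hD1 : ∀ i, D i (1 : FreeAlgebra k (Fin m)) = 0)
    (hDx : ∀ i j, D i (FreeAlgebra.ι k j) = if i = j then 1 else 0)
    (hDmul : ∀ i (u v : FreeAlgebra k (Fin m)),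
      D i (u * v) = D i u * act (dg i) v + u * D i v)
    (i₁ i₂ : Fin m) (hne : i₁ ≠ i₂)
    (q₁₂ q₂₁ q₂₂ : k) (hq₁₂ : q₁₂ ≠ 0) (hq₂₁ : q₂₁ ≠ 0) (hq₂₂ : q₂₂ ≠ 0)
    (h11 : act (dg i₁) (FreeAlgebra.ι k i₁) = FreeAlgebra.ι k i₁)
    (h12 : act (dg i₁) (FreeAlgebra.ι k i₂) = q₁₂ • FreeAlgebra.ι k i₂)
    (h21 : act (dg i₂) (FreeAlgebra.ι k i₁) = q₂₁ • FreeAlgebra.ι k i₁)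
    (h22 : act (dg i₂) (FreeAlgebra.ι k i₂) = q₂₂ • FreeAlgebra.ι k i₂)
    (hq : q₁₂ * q₂₁ ≠ 1) :
    GKdim k (RingQuot (nicholsRel D)) = ⊤ := by
  let π := RingQuot.mkAlgHom k (nicholsRel D)
  let S : Set (RingQuot (nicholsRel D)) :=
    {1, π (FreeAlgebra.ι k i₁), π (FreeAlgebra.ι k i₂)}
  have : FiniteDimensional k (Submodule.span k S) :=
    FiniteDimensional.span_of_finite k (by simp [S])
  refine GKdim_eq_top_of_two_pow_le (Submodule.span k S) fun N => ?_
  obtain ⟨ι, _, v, hcard, hV, -, -, hind⟩ := exists_independent_products hD1 hDx hDmul hne h11 h12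
    h21 h22 hq π (V := Submodule.span k S)
    (Submodule.one_le.2 (Submodule.subset_span (by simp [S])))
    (Submodule.subset_span (by simp [S])) (Submodule.subset_span (by simp [S])) N
  refine ⟨ι, inferInstance, π ∘ v, hcard, hV, Fintype.linearIndependent_iff.2 fun g hg => ?_⟩
  refine hind g fun r =>
    mem_nicholsLayer_of_mkAlgHom_eq_zero hactmul hYD hD1 hDx hDmul ?_ r
  simpa [π] using hg
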